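/- Let A, B ∈ SL₂(ℂ) be such that (tr A)² ≠ 4 (so A has two distinct eigenvalues) and such that there is no nonzero vector v ∈ ℂ² with both Av and Bv scalar multiples of v (the pair {A, B} is irreducible). Then there exists P ∈ SL₂(ℂ) with P A P⁻¹ = A⁻¹ and P B P⁻¹ = B⁻¹. -/

import Mathlib

open Matrix

abbrev SL2C := Matrix.SpecialLinearGroup (Fin 2) ℂ

/-- The kernel of a nonzero `2 × 2` matrix is at most one-dimensional. -/
theorem exists_eq_smul_of_mulVec_eq_zero {K : Type*} [Field K] {M : Matrix (Fin 2) (Fin 2) K}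
    (hM : M ≠ 0) {v w : Fin 2 → K} (hv : v ≠ 0) (hMv : M *ᵥ v = 0) (hMw : M *ᵥ w = 0) :
    ∃ c : K, w = c • v := by
  have hD : v 0 * w 1 - v 1 * w 0 = 0 := by
    by_contra hD
    apply hM
    ext i j
    have h1 := congrFun hMv i
    have h2 := congrFun hMw i
    simp only [mulVec, dotProduct, Fin.sum_univ_two, Pi.zero_apply] at h1 h2
    apply (mul_eq_zero.mp (?_ : M i j * (v 0 * w 1 - v 1 * w 0) = 0)).resolve_right hD
    fin_cases j
    · simp only [Fin.zero_eta]
      linear_combination w 1 * h1 - v 1 * h2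
    · simp only [Fin.mk_one]
      linear_combination v 0 * h2 - w 0 * h1
  by_cases h0 : v 0 = 0
  · have h1 : v 1 ≠ 0 := fun h1 => hv (by ext i; fin_cases i <;> simp [h0, h1])
    refine ⟨w 1 / v 1, ?_⟩
    ext i
    fin_cases i
    · simp only [Fin.zero_eta, Pi.smul_apply, smul_eq_mul]
      field_simp
      linear_combination -hD
    · simp [h1]
  · refine ⟨w 0 / v 0, ?_⟩
    ext i
    fin_cases i
    · simp [h0]
    · simp only [Fin.mk_one, Pi.smul_apply, smul_eq_mul]
      field_simp
      linear_combination hD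

/-- A `2 × 2` complex matrix has an eigenvector. -/
theorem exists_mulVec_eq_smul (A : Matrix (Fin 2) (Fin 2) ℂ) :
    ∃ (a : ℂ) (v : Fin 2 → ℂ), v ≠ 0 ∧ A *ᵥ v = a • v := by
  obtain ⟨a, ha⟩ := Module.End.exists_eigenvalue (Matrix.toLin' A)
  obtain ⟨v, hv⟩ := ha.exists_hasEigenvector
  exact ⟨a, v, hv.2, by simpa using hv.apply_eq_smul⟩

/-- The commutator `AB - BA` intertwines `A` with its adjugate. -/
theorem commutator_mul_left {R : Type*} [CommRing R] (A B : Matrix (Fin 2) (Fin 2) R) :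
    (A * B - B * A) * A = A.adjugate * (A * B - B * A) := by
  ext i j
  fin_cases i <;> fin_cases j <;>
    simp [Matrix.mul_apply, Fin.sum_univ_two, adjugate_fin_two] <;> ring

/-- The commutator `AB - BA` intertwines `B` with its adjugate. -/
theorem commutator_mul_right {R : Type*} [CommRing R] (A B : Matrix (Fin 2) (Fin 2) R) :
    (A * B - B * A) * B = B.adjugate * (A * B - B * A) := by
  have h := commutator_mul_left B A
  rw [← neg_sub (B * A), neg_mul, mul_neg, h]

/-- If `AB - BA` is singular and `(tr A)² ≠ 4 det A`, then `A` and `B` share an eigenvector. -/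
theorem exists_common_eigenvector_of_det_commutator_eq_zero {A B : Matrix (Fin 2) (Fin 2) ℂ}
    (htr : A.trace ^ 2 ≠ 4 * A.det) (hdet : (A * B - B * A).det = 0) :
    ∃ v : Fin 2 → ℂ, v ≠ 0 ∧ (∃ a : ℂ, A *ᵥ v = a • v) ∧ (∃ b : ℂ, B *ᵥ v = b • v) := by
  by_cases hC : A * B - B * A = 0
  · obtain ⟨a, v, hv, hAv⟩ := exists_mulVec_eq_smul A
    have hM : A - a • (1 : Matrix (Fin 2) (Fin 2) ℂ) ≠ 0 := by
      intro h
      rw [sub_eq_zero] at h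
      apply htr
      rw [h]
      simp
      ring
    refine ⟨v, hv, ⟨a, hAv⟩, exists_eq_smul_of_mulVec_eq_zero hM hv ?_ ?_⟩
    · rw [sub_mulVec, hAv, smul_mulVec, one_mulVec, sub_self]
    · rw [sub_mulVec, mulVec_mulVec, sub_eq_zero.mp hC, ← mulVec_mulVec, hAv, smul_mulVec,
        one_mulVec, mulVec_smul, sub_self]
  · obtain ⟨v, hv, hCv⟩ := exists_mulVec_eq_zero_iff.mpr hdet
    refine ⟨v, hv, exists_eq_smul_of_mulVec_eq_zero hC hv hCv ?_,
      exists_eq_smul_of_mulVec_eq_zero hC hv hCv ?_⟩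
    · rw [mulVec_mulVec, commutator_mul_left, ← mulVec_mulVec, hCv, mulVec_zero]
    · rw [mulVec_mulVec, commutator_mul_right, ← mulVec_mulVec, hCv, mulVec_zero]

/-- if `A ∈ SL₂(ℂ)` has `(tr A)² ≠ 4` and the pair `{A, B}` is irreducible,
then there is `P ∈ SL₂(ℂ)` conjugating both `A` and `B` to their inverses. -/
theorem irreducible_pair_conjugate_to_inverses (A B : SL2C)
    (htr : (Matrix.trace ((A : Matrix (Fin 2) (Fin 2) ℂ))) ^ 2 ≠ 4)
    (hirr : ¬ ∃ v : Fin 2 → ℂ, v ≠ 0 ∧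
      (∃ a : ℂ, (A : Matrix (Fin 2) (Fin 2) ℂ) *ᵥ v = a • v) ∧
      (∃ b : ℂ, (B : Matrix (Fin 2) (Fin 2) ℂ) *ᵥ v = b • v)) :
    ∃ P : SL2C, P * A * P⁻¹ = A⁻¹ ∧ P * B * P⁻¹ = B⁻¹ := by
  set C : Matrix (Fin 2) (Fin 2) ℂ := A.1 * B.1 - B.1 * A.1 with hC
  have hdet : C.det ≠ 0 := fun h =>
    hirr (exists_common_eigenvector_of_det_commutator_eq_zero (by simpa [A.2] using htr) h)
  obtain ⟨s, hs⟩ := IsAlgClosed.exists_pow_nat_eq C.det (n := 2) two_pos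
  have hP : (s⁻¹ • C).det = 1 := by
    rw [det_smul, Fintype.card_fin, inv_pow, hs, inv_mul_cancel₀ hdet]
  obtain ⟨P, hPC⟩ : ∃ P : SL2C, (P : Matrix (Fin 2) (Fin 2) ℂ) = s⁻¹ • C := ⟨⟨_, hP⟩, rfl⟩
  refine ⟨P, ?_, ?_⟩ <;> rw [mul_inv_eq_iff_eq_mul] <;> apply Subtype.ext
  · change P.1 * A.1 = A.1.adjugate * P.1
    rw [hPC, smul_mul_assoc, mul_smul_comm, hC, commutator_mul_left]
  · change P.1 * B.1 = B.1.adjugate * P.1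
    rw [hPC, smul_mul_assoc, mul_smul_comm, hC, commutator_mul_right]
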